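/- For every half-integer r ∈ ℤ + 1/2, the state v^{(r)} with coordinates v^{(r)}_i = r·i/(n−2) is a critical point of U: the gradient of U vanishes at v^{(r)}. -/

import Mathlib

/-- Cyclic successor on `Fin n`. -/
def fsucc {n : ℕ} (i : Fin n) : Fin n := ⟨((i : ℕ) + 1) % n, Nat.mod_lt _ i.pos⟩

/-- The nearest-neighbor Kuramoto potential on `ℝ^n`. -/
noncomputable def Unn (n : ℕ) (K : ℝ) (u : Fin n → ℝ) : ℝ :=
  -(K / (2 * Real.pi)) * ∑ i : Fin n, Real.cos (2 * Real.pi * (u (fsucc i) - u i))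

/-- The saddle candidate state `v^{(r)}_i = r·i/(n−2)`. -/
noncomputable def vstate (n : ℕ) (r : ℝ) : Fin n → ℝ := fun i => r * (i : ℕ) / ((n : ℝ) - 2)

theorem fsucc_injective {n : ℕ} : Function.Injective (fsucc : Fin n → Fin n) := by
  intro i j h
  have h' : ((i : ℕ) + 1) % n = ((j : ℕ) + 1) % n := congrArg Fin.val h
  have hij : (i : ℕ) ≡ j [MOD n] := Nat.ModEq.add_right_cancel' 1 h'
  exact Fin.ext (hij.eq_of_lt_of_lt i.isLt j.isLt)

theorem sum_comp_fsucc {n : ℕ} (f : Fin n → ℝ) : ∑ i, f (fsucc i) = ∑ i, f i :=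
  (Finite.injective_iff_bijective.mp fsucc_injective).sum_comp f

theorem hasFDerivAt_Unn (n : ℕ) (K : ℝ) (u : Fin n → ℝ) :
    HasFDerivAt (Unn n K)
      (-(K / (2 * Real.pi)) • ∑ i : Fin n, -Real.sin (2 * Real.pi * (u (fsucc i) - u i)) •
        (2 * Real.pi) • (ContinuousLinearMap.proj (R := ℝ) (φ := fun _ : Fin n => ℝ) (fsucc i) -
          ContinuousLinearMap.proj i)) u := by
  refine HasFDerivAt.const_mul (HasFDerivAt.fun_sum fun i _ => ?_) _
  exact (((hasFDerivAt_apply (fsucc i) u).sub (hasFDerivAt_apply i u)).const_mul _).cos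

theorem sin_vstate_sub {n : ℕ} (hn : 3 ≤ n) (m : ℤ) (i : Fin n) :
    Real.sin (2 * Real.pi * (vstate n (m + 1 / 2) (fsucc i) - vstate n (m + 1 / 2) i)) =
      Real.sin (2 * Real.pi * (((m : ℝ) + 1 / 2) / ((n : ℝ) - 2))) := by
  have hn' : (n : ℝ) - 2 ≠ 0 := by
    have : (3 : ℝ) ≤ n := by exact_mod_cast hn
    linarith
  rcases (Nat.succ_le_of_lt i.isLt).lt_or_eq with h | h
  · have hs : ((fsucc i : Fin n) : ℕ) = i + 1 := Nat.mod_eq_of_lt h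
    simp only [vstate, hs]
    push_cast
    congr 1
    ring
  · have hs : ((fsucc i : Fin n) : ℕ) = 0 := by
      change ((i : ℕ) + 1) % n = 0
      rw [← Nat.succ_eq_add_one, h, Nat.mod_self]
    have hi : ((i : ℕ) : ℝ) = n - 1 := by
      rw [eq_sub_iff_add_eq]
      exact_mod_cast h
    simp only [vstate, hs, hi]
    set x := 2 * Real.pi * (((m : ℝ) + 1 / 2) / ((n : ℝ) - 2)) with hx
    have : 2 * Real.pi * (((m : ℝ) + 1 / 2) * ((0 : ℕ) : ℝ) / (n - 2) -
        ((m : ℝ) + 1 / 2) * (n - 1) / (n - 2)) = -(x + Real.pi) - m * (2 * Real.pi) := by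
      rw [hx]
      push_cast
      field_simp
      ring
    rw [this, Real.sin_sub_int_mul_two_pi, Real.sin_neg, Real.sin_add_pi, neg_neg]

/-- For every half-integer `r ∈ ℤ + 1/2`, the state `v^{(r)}` with coordinates
`v^{(r)}_i = r·i/(n−2)` is a critical point of the Kuramoto potential `U`. -/
theorem half_integer_state_is_critical (n : ℕ) (hn : 3 ≤ n) (K : ℝ) (hK : 0 < K)
    (r : ℝ) (hr : ∃ m : ℤ, r = (m : ℝ) + 1 / 2) :
    fderiv ℝ (Unn n K) (vstate n r) = 0 := by
  obtain ⟨m, rfl⟩ := hr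
  rw [(hasFDerivAt_Unn n K _).fderiv]
  simp only [sin_vstate_sub hn]
  ext1 h
  simp [← Finset.mul_sum, Finset.sum_sub_distrib, sum_comp_fsucc h]
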